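/- Suppose 𝒰 ⊆ ℳ is relatively open in ℳ. Then the good lamination convex hull 𝒰^{lc,Λ_g} is relatively open in ℳ. -/

import Mathlib

noncomputable section

/-- Vectors in ℝ³. -/
abbrev V3 : Type := Fin 3 → ℝ

/-- Euclidean inner product on ℝ³. -/
def dot3 (a b : V3) : ℝ := ∑ i, a i * b i

/-- Cross product on ℝ³. -/
def cross3 (a b : V3) : V3 :=
  ![a 1 * b 2 - a 2 * b 1, a 2 * b 0 - a 0 * b 2, a 0 * b 1 - a 1 * b 0]

/-- Euclidean norm on ℝ³. -/
def eNorm3 (a : V3) : ℝ := Real.sqrt (∑ i, (a i) ^ 2)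

/-- 3×3 real matrices. -/
abbrev Mat3 : Type := Matrix (Fin 3) (Fin 3) ℝ

/-- A state is a tuple V = (u, S, B, E). -/
abbrev MHDState : Type := V3 × Mat3 × V3 × V3

/-- The Euclidean norm on the state space. -/
def stateNorm (V : MHDState) : ℝ :=
  Real.sqrt ((∑ i, (V.1 i) ^ 2) + (∑ i, ∑ j, (V.2.1 i j) ^ 2) +
    (∑ i, (V.2.2.1 i) ^ 2) + (∑ i, (V.2.2.2 i) ^ 2))

/-- ξ = (ξ_x, ξ_t) annihilates the state V = (u, S, B, E) if ξ_x·u = 0, ξ_x·B = 0,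
ξ_t u + S ξ_x = 0 and ξ_t B + ξ_x × E = 0. -/
def Annihilates (ξx : V3) (ξt : ℝ) (V : MHDState) : Prop :=
  dot3 ξx V.1 = 0 ∧ dot3 ξx V.2.2.1 = 0 ∧
  ξt • V.1 + V.2.1.mulVec ξx = 0 ∧
  ξt • V.2.2.1 + cross3 ξx V.2.2.2 = 0

/-- The wave cone Λ: states with symmetric S admitting some ξ with ξ_x ≠ 0
annihilating them. -/
def WaveCone : Set MHDState :=
  {V | V.2.1.IsSymm ∧ ∃ ξx : V3, ∃ ξt : ℝ, ξx ≠ 0 ∧ Annihilates ξx ξt V}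

/-- The set ℳ of states (with symmetric S) satisfying B·E = 0. -/
def MSet : Set MHDState :=
  {V | V.2.1.IsSymm ∧ dot3 V.2.2.1 V.2.2.2 = 0}

/-- The segment [V₀ − (1−λ)V, V₀ + λV] is a good Λ-segment. -/
def GoodSegment (V₀ V : MHDState) (lam : ℝ) : Prop :=
  V₀ ∈ MSet ∧ V ∈ WaveCone ∧ 0 < lam ∧ lam < 1 ∧
  (∀ t : ℝ, -(1 - lam) ≤ t → t ≤ lam → V₀ + t • V ∈ MSet) ∧
  ∃ ξx : V3, ∃ ξt : ℝ, ξx ≠ 0 ∧ Annihilates ξx ξt V ∧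
    ((V.2.2.1 = 0 ∧ V.2.2.2 = 0) ∨
     (dot3 ξx V₀.2.2.1 ≠ 0 ∨ ξt • V₀.2.2.1 + cross3 ξx V₀.2.2.2 ≠ 0) ∨
     (∃ k : ℝ, k ≠ -(1 / lam) ∧ k ≠ 1 / (1 - lam) ∧
       V.2.2.1 = k • V₀.2.2.1 ∧ V.2.2.2 = k • V₀.2.2.2 ∧
       ¬(V.2.2.1 = 0 ∧ V.2.2.2 = 0)) ∨
     (V.1 = 0 ∧ V.2.1 = 0 ∧ V₀.2.2.1 = 0 ∧ V₀.2.2.2 = 0))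

/-- The iterated lamination sets Y^{N,Λ}. -/
def lamHull (Y : Set MHDState) : ℕ → Set MHDState
  | 0 => Y
  | N + 1 => lamHull Y N ∪
      {Z | ∃ lam : ℝ, ∃ V W : MHDState, 0 ≤ lam ∧ lam ≤ 1 ∧
        V ∈ lamHull Y N ∧ W ∈ lamHull Y N ∧ V - W ∈ WaveCone ∧
        Z = lam • V + (1 - lam) • W}

/-- The lamination convex hull Y^{lc,Λ}. -/
def lcHull (Y : Set MHDState) : Set MHDState := ⋃ N : ℕ, lamHull Y N

/-- The iterated good lamination sets Y^{k,Λ_g}. -/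
def lamHullG (Y : Set MHDState) : ℕ → Set MHDState
  | 0 => Y
  | k + 1 => lamHullG Y k ∪
      {V₀ | ∃ lam : ℝ, ∃ V : MHDState, GoodSegment V₀ V lam ∧
        V₀ + lam • V ∈ lamHullG Y k ∧ V₀ - (1 - lam) • V ∈ lamHullG Y k}

/-- The good lamination convex hull Y^{lc,Λ_g}. -/
def lcHullG (Y : Set MHDState) : Set MHDState := ⋃ k : ℕ, lamHullG Y k

/-- A set of states is relatively open in ℳ. -/
def RelOpen (U : Set MHDState) : Prop :=
  ∀ V ∈ U, ∃ δ : ℝ, 0 < δ ∧ ∀ W ∈ MSet, stateNorm (W - V) < δ → W ∈ U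

/-- The tensor product a⊗b of two vectors in ℝ³. -/
def outer (a b : V3) : Mat3 := Matrix.of fun i j => a i * b j

/-- The constitutive set K_{r,s}. -/
def Kset (r s : ℝ) : Set MHDState :=
  {V | ∃ q : ℝ, |q| ≤ r * s ∧
    V.2.1 = outer V.1 V.1 - outer V.2.2.1 V.2.2.1 + q • (1 : Mat3) ∧
    V.2.2.2 = cross3 V.2.2.1 V.1 ∧
    eNorm3 (V.1 + V.2.2.1) = r ∧ eNorm3 (V.1 - V.2.2.1) = s}

/-- 𝒰_{r,s}: the relative interior of K_{r,s}^{lc,Λ} in ℳ. -/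
def Uset (r s : ℝ) : Set MHDState :=
  {V | V ∈ MSet ∧ ∃ δ : ℝ, 0 < δ ∧
    ∀ W ∈ MSet, stateNorm (W - V) < δ → W ∈ lcHull (Kset r s)}

/-- The Frobenius norm on 3×3 matrices. -/
def frobNorm (M : Mat3) : ℝ := Real.sqrt (∑ i, ∑ j, (M i j) ^ 2)

/-- The relatively open sets 𝒱_{r',s',c}. -/
def Vset (r' s' c : ℝ) : Set MHDState :=
  {V | V.2.1.IsSymm ∧ dot3 V.2.2.1 V.2.2.2 = 0 ∧ ∃ q : ℝ,
    eNorm3 (V.1 + V.2.2.1) < r' + c ∧ eNorm3 (V.1 - V.2.2.1) < s' + c ∧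
    frobNorm (V.2.1 - (outer V.1 V.1 - outer V.2.2.1 V.2.2.1) - q • (1 : Mat3)) < c ∧
    |q| < r' * s' + c ∧ eNorm3 (V.2.2.2 - cross3 V.2.2.1 V.1) < c}

open Filter Topology

/-- Euclidean inner product on space-time covectors. -/
def dot4 (a b : V3 × ℝ) : ℝ := dot3 a.1 b.1 + a.2 * b.2

/-- The magnetic and electric part of the wedge product of two covectors, as a state. -/
def wedge (a b : V3 × ℝ) : MHDState :=
  (0, 0, cross3 a.1 b.1, b.2 • a.1 - a.2 • b.1)

/-- The covector dual to the wedge product of `a` with the form `(B, E)`. -/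
def cov (a : V3 × ℝ) (W : MHDState) : V3 × ℝ :=
  (-(a.2 • W.2.2.1 + cross3 a.1 W.2.2.2), dot3 a.1 W.2.2.1)

/-- The polarization of the quadratic form `2 B · E`. -/
def pair (V W : MHDState) : ℝ := dot3 V.2.2.1 W.2.2.2 + dot3 V.2.2.2 W.2.2.1

section Algebra

theorem dot3_eq (a b : V3) : dot3 a b = a 0 * b 0 + a 1 * b 1 + a 2 * b 2 := by
  simp [dot3, Fin.sum_univ_three]

theorem V3.ext_iff' {a b : V3} : a = b ↔ a 0 = b 0 ∧ a 1 = b 1 ∧ a 2 = b 2 := by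
  simp [funext_iff, Fin.forall_fin_succ]

theorem dot3_self_pos {a : V3} (ha : a ≠ 0) : 0 < dot3 a a := by
  rw [dot3_eq]
  by_contra! h
  refine ha (V3.ext_iff'.2 ⟨?_, ?_, ?_⟩) <;> simp only [Pi.zero_apply] <;>
    nlinarith [sq_nonneg (a 0), sq_nonneg (a 1), sq_nonneg (a 2)]

theorem dot3_self_nonneg (a : V3) : 0 ≤ dot3 a a := by
  rw [dot3_eq]
  linarith [mul_self_nonneg (a 0), mul_self_nonneg (a 1), mul_self_nonneg (a 2)]

theorem add_dot3_self_pos {a b : V3} (h : ¬(a = 0 ∧ b = 0)) : 0 < dot3 a a + dot3 b b := by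
  by_cases ha : a = 0
  · exact add_pos_of_nonneg_of_pos (dot3_self_nonneg a) (dot3_self_pos fun hb => h ⟨ha, hb⟩)
  · exact add_pos_of_pos_of_nonneg (dot3_self_pos ha) (dot3_self_nonneg b)

theorem dot4_comm (a b : V3 × ℝ) : dot4 a b = dot4 b a := by
  simp only [dot4, dot3_eq]; ring

theorem dot4_smul (a b : V3 × ℝ) (s : ℝ) : dot4 a (s • b) = s * dot4 a b := by
  simp only [dot4, dot3_eq, Prod.smul_fst, Prod.smul_snd, Pi.smul_apply, smul_eq_mul]; ring

theorem dot4_smul_smul (a : V3 × ℝ) (s : ℝ) : dot4 (s • a) (s • a) = s ^ 2 * dot4 a a := by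
  rw [dot4_smul, dot4_comm, dot4_smul, ← mul_assoc, pow_two]

theorem dot4_neg (a b : V3 × ℝ) : dot4 a (-b) = -dot4 a b := by
  simpa using dot4_smul a b (-1)

theorem dot4_self_nonneg (a : V3 × ℝ) : 0 ≤ dot4 a a := by
  simp only [dot4, dot3_eq]
  linarith [mul_self_nonneg (a.1 0), mul_self_nonneg (a.1 1), mul_self_nonneg (a.1 2),
    mul_self_nonneg a.2]

theorem dot4_self_pos {a : V3 × ℝ} (ha : a ≠ 0) : 0 < dot4 a a := by
  by_contra! h
  by_cases h1 : a.1 = 0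
  · have h2 : a.2 = 0 := by
      simp only [dot4, h1, dot3_eq, Pi.zero_apply] at h
      nlinarith [sq_nonneg a.2]
    exact ha (Prod.ext h1 h2)
  · have := dot3_self_pos h1
    simp only [dot4] at h
    nlinarith [sq_nonneg a.2]

theorem annihilates_wedge (a b : V3 × ℝ) : Annihilates a.1 a.2 (wedge a b) := by
  simp only [Annihilates, wedge, dot3_eq, cross3, V3.ext_iff']
  simp
  refine ⟨?_, ?_, ?_, ?_⟩ <;> ring

theorem annihilates_add {x : V3} {t : ℝ} {V W : MHDState} (hV : Annihilates x t V)
    (hW : Annihilates x t W) : Annihilates x t (V + W) := by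
  obtain ⟨h1, h2, h3, h4⟩ := hV
  obtain ⟨k1, k2, k3, k4⟩ := hW
  refine ⟨?_, ?_, ?_, ?_⟩
  · simp only [dot3_eq, Prod.fst_add, Pi.add_apply] at *; linarith
  · simp only [dot3_eq, Prod.fst_add, Prod.snd_add, Pi.add_apply] at *; linarith
  · have : t • (V + W).1 + (V + W).2.1.mulVec x
        = (t • V.1 + V.2.1.mulVec x) + (t • W.1 + W.2.1.mulVec x) := by
      simp only [Prod.fst_add, Prod.snd_add, Matrix.add_mulVec, smul_add]; abel
    rw [this, h3, k3, add_zero]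
  · simp only [V3.ext_iff', cross3, Prod.snd_add, Prod.fst_add, Pi.add_apply, Pi.smul_apply,
      smul_eq_mul, Pi.zero_apply, Matrix.cons_val] at h4 k4 ⊢
    exact ⟨by linarith, by linarith, by linarith⟩

theorem wedge_swap (a b : V3 × ℝ) : wedge a b = wedge b (-a) := by
  simp only [wedge, Prod.mk.injEq, V3.ext_iff', cross3, true_and]
  simp; refine ⟨⟨?_, ?_, ?_⟩, ?_, ?_, ?_⟩ <;> ring

theorem wedge_neg (a b : V3 × ℝ) : wedge a (-b) = -wedge a b := by
  simp only [wedge, Prod.neg_mk, neg_zero, Prod.mk.injEq, V3.ext_iff', cross3, true_and]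
  simp; refine ⟨⟨?_, ?_, ?_⟩, ?_, ?_, ?_⟩ <;> ring

theorem wedge_smul (a b : V3 × ℝ) (s : ℝ) : wedge a (s • b) = s • wedge a b := by
  simp only [wedge, Prod.smul_mk, smul_zero, Prod.mk.injEq, V3.ext_iff', cross3, true_and]
  simp; refine ⟨⟨?_, ?_, ?_⟩, ?_, ?_, ?_⟩ <;> ring

theorem wedge_add_self (a b : V3 × ℝ) : wedge a (b + a) = wedge a b := by
  simp only [wedge, Prod.mk.injEq, V3.ext_iff', cross3, true_and]
  simp; refine ⟨⟨?_, ?_, ?_⟩, ?_, ?_, ?_⟩ <;> ring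

theorem pair_wedge (a b : V3 × ℝ) (W : MHDState) : pair (wedge a b) W = dot4 (cov a W) b := by
  simp only [pair, wedge, dot4, cov, dot3_eq, cross3, Pi.add_apply, Pi.sub_apply, Pi.neg_apply,
    Pi.smul_apply, smul_eq_mul, Matrix.cons_val]
  ring

theorem pair_add (V V' W : MHDState) : pair (V + V') W = pair V W + pair V' W := by
  simp only [pair, dot3_eq, Prod.snd_add, Prod.fst_add, Pi.add_apply]; ring

theorem pair_comm (V W : MHDState) : pair V W = pair W V := by
  simp only [pair, dot3_eq]; ring

theorem pair_wedge_wedge (a b g : V3 × ℝ) : pair (wedge a b) (wedge a g) = 0 := by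
  simp only [pair, wedge, dot3_eq, cross3]
  simp
  ring

theorem Annihilates.dot3_eq_zero {x : V3} {t : ℝ} {V : MHDState} (hx : x ≠ 0)
    (h : Annihilates x t V) : dot3 V.2.2.1 V.2.2.2 = 0 := by
  obtain ⟨-, h2, -, h4⟩ := h
  have hp := dot3_self_pos hx
  have key : dot3 x x * dot3 V.2.2.1 V.2.2.2 = 0 := by
    simp only [V3.ext_iff', cross3, dot3_eq, Pi.add_apply, Pi.smul_apply,
      smul_eq_mul, Pi.zero_apply, Matrix.cons_val] at h2 h4 ⊢
    obtain ⟨e0, e1, e2⟩ := h4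
    linear_combination (x 0 * V.2.2.2 0 + x 1 * V.2.2.2 1 + x 2 * V.2.2.2 2) * h2
      + (x 1 * V.2.2.1 2 - x 2 * V.2.2.1 1) * e0 + (x 2 * V.2.2.1 0 - x 0 * V.2.2.1 2) * e1
      + (x 0 * V.2.2.1 1 - x 1 * V.2.2.1 0) * e2
  exact (mul_eq_zero.1 key).resolve_left hp.ne'

/-- An electromagnetic form annihilated by `a` is a multiple of `a`. -/
theorem Annihilates.exists_wedge {a : V3 × ℝ} {V : MHDState} (ha : a.1 ≠ 0)
    (h : Annihilates a.1 a.2 V) (hu : V.1 = 0) (hS : V.2.1 = 0) :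
    ∃ b : V3 × ℝ, b.1 ≠ 0 ∧ V = wedge a b := by
  obtain ⟨-, h2, -, h4⟩ := h
  have hp := dot3_self_pos ha
  obtain ⟨b, hb⟩ : ∃ b : V3 × ℝ, V = wedge a b := by
    refine ⟨(-((dot3 a.1 a.1)⁻¹ • cross3 a.1 V.2.2.1), (dot3 a.1 a.1)⁻¹ * dot3 V.2.2.2 a.1), ?_⟩
    obtain ⟨u, S, B, E⟩ := V
    simp only at hu hS h2 h4
    subst hu hS
    have hr := inv_mul_cancel₀ hp.ne'
    generalize (dot3 a.1 a.1)⁻¹ = r at hr ⊢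
    simp only [V3.ext_iff', cross3, dot3_eq, Pi.add_apply, Pi.smul_apply,
      smul_eq_mul, Pi.zero_apply, Matrix.cons_val] at h2 h4 hr
    obtain ⟨e0, e1, e2⟩ := h4
    simp only [wedge, Prod.mk.injEq, true_and, V3.ext_iff', cross3, dot3_eq, Pi.sub_apply,
      Pi.smul_apply, Pi.neg_apply, smul_eq_mul, Matrix.cons_val]
    refine ⟨⟨?_, ?_, ?_⟩, ?_, ?_, ?_⟩
    · linear_combination r * (a.1 0 * h2) - B 0 * hr
    · linear_combination r * (a.1 1 * h2) - B 1 * hr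
    · linear_combination r * (a.1 2 * h2) - B 2 * hr
    · linear_combination r * (a.1 2 * e1 - a.1 1 * e2) - E 0 * hr
    · linear_combination r * (a.1 0 * e2 - a.1 2 * e0) - E 1 * hr
    · linear_combination r * (a.1 1 * e0 - a.1 0 * e1) - E 2 * hr
  by_cases h0 : b.1 = 0
  · exact ⟨b + a, by simpa [h0] using ha, by rw [hb, wedge_add_self]⟩
  · exact ⟨b, h0, hb⟩

/-- A form annihilated by two independent covectors is a multiple of their wedge product. -/
theorem eq_smul_wedge {a b : V3 × ℝ} {W : MHDState} (ha : cov a W = 0) (hb : cov b W = 0)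
    (hN : 0 < dot4 a a * dot4 b b - dot4 a b ^ 2) :
    W.2.2.1 = ((dot3 (wedge a b).2.2.1 W.2.2.1 + dot3 (wedge a b).2.2.2 W.2.2.2) /
        (dot4 a a * dot4 b b - dot4 a b ^ 2)) • (wedge a b).2.2.1 ∧
    W.2.2.2 = ((dot3 (wedge a b).2.2.1 W.2.2.1 + dot3 (wedge a b).2.2.2 W.2.2.2) /
        (dot4 a a * dot4 b b - dot4 a b ^ 2)) • (wedge a b).2.2.2 := by
  have hr := mul_inv_cancel₀ hN.ne'
  simp only [div_eq_mul_inv]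
  generalize (dot4 a a * dot4 b b - dot4 a b ^ 2)⁻¹ = r at hr ⊢
  clear hN
  obtain ⟨a, p⟩ := a
  obtain ⟨b, q⟩ := b
  obtain ⟨u, S, B, E⟩ := W
  simp only [cov, Prod.mk_eq_zero, neg_eq_zero, wedge, V3.ext_iff', cross3, dot3_eq, dot4,
    Pi.add_apply, Pi.sub_apply, Pi.smul_apply, smul_eq_mul, Matrix.cons_val, Pi.zero_apply] at *
  obtain ⟨⟨a0, a1, a2⟩, a3⟩ := ha
  obtain ⟨⟨b0, b1, b2⟩, b3⟩ := hb
  refine ⟨⟨?_, ?_, ?_⟩, ?_, ?_, ?_⟩ <;> grind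

theorem dot4_gram (a b : V3 × ℝ) : dot4 a a * dot4 b b - dot4 a b ^ 2 =
    dot3 (wedge a b).2.2.1 (wedge a b).2.2.1 + dot3 (wedge a b).2.2.2 (wedge a b).2.2.2 := by
  simp only [wedge, cross3, dot3_eq, dot4, Pi.sub_apply, Pi.smul_apply, smul_eq_mul,
    Matrix.cons_val]
  ring

theorem dot4_cov_wedge {a b g : V3 × ℝ} (ha : dot4 a g = 0) (hb : dot4 b g = 0) :
    dot4 (cov b (wedge a g)) (cov b (wedge a g)) =
      dot4 g g * (dot4 a a * dot4 b b - dot4 a b ^ 2) := by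
  have : dot4 (cov b (wedge a g)) (cov b (wedge a g)) =
      dot4 g g * (dot4 a a * dot4 b b - dot4 a b ^ 2) - dot4 a a * dot4 b g ^ 2
        - dot4 b b * dot4 a g ^ 2 + 2 * dot4 a b * dot4 b g * dot4 a g := by
    simp only [cov, wedge, cross3, dot3_eq, dot4, Pi.sub_apply, Pi.smul_apply, smul_eq_mul,
      Matrix.cons_val, Pi.add_apply, Pi.neg_apply]
    ring
  rw [this, ha, hb]; ring

theorem half_sub_le_dot4_cov (b : V3 × ℝ) (V W : MHDState) :
    dot4 (cov b V) (cov b V) / 2 - dot4 (cov b W) (cov b W) ≤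
      dot4 (cov b (W + V)) (cov b (W + V)) := by
  have hc : cov b (W + V) = cov b W + cov b V := by
    simp only [cov, cross3, dot3_eq, Prod.mk_add_mk, Prod.mk.injEq, V3.ext_iff']
    simp; refine ⟨⟨?_, ?_, ?_⟩, ?_⟩ <;> ring
  have h := dot4_self_nonneg ((2 : ℝ) • cov b W + cov b V)
  rw [hc]
  simp only [dot4, dot3_eq, Prod.fst_add, Prod.snd_add, Prod.smul_fst, Prod.smul_snd,
    Pi.add_apply, Pi.smul_apply, smul_eq_mul] at h ⊢
  linarith

theorem exists_dot4_orthogonal (a b c : V3 × ℝ) {s : ℝ} (hs : 0 < s) :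
    ∃ g : V3 × ℝ, dot4 a g = 0 ∧ dot4 b g = 0 ∧ dot4 c g = 0 ∧ dot4 g g = s := by
  obtain ⟨v, hv0, hv⟩ := (Matrix.exists_mulVec_eq_zero_iff
    (M := !![a.1 0, a.1 1, a.1 2, a.2; b.1 0, b.1 1, b.1 2, b.2; c.1 0, c.1 1, c.1 2, c.2;
      0, 0, 0, 0])).2 (Matrix.det_eq_zero_of_row_eq_zero 3 (by
        intro j; fin_cases j <;> rfl))
  set g : V3 × ℝ := (![v 0, v 1, v 2], v 3) with hg
  have hg0 : g ≠ 0 := by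
    intro h
    apply hv0
    simp only [hg, Prod.mk_eq_zero, V3.ext_iff', Matrix.cons_val, Pi.zero_apply] at h
    ext j; fin_cases j
    exacts [h.1.1, h.1.2.1, h.1.2.2, h.2]
  have hp := dot4_self_pos hg0
  have hv' := fun i => congrFun hv i
  have e0 := hv' 0
  have e1 := hv' 1
  have e2 := hv' 2
  simp [Matrix.mulVec, dotProduct, Fin.sum_univ_four] at e0 e1 e2
  have d0 : dot4 a g = 0 := by simp [dot4, dot3_eq, hg]; linarith
  have d1 : dot4 b g = 0 := by simp [dot4, dot3_eq, hg]; linarith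
  have d2 : dot4 c g = 0 := by simp [dot4, dot3_eq, hg]; linarith
  refine ⟨√(s / dot4 g g) • g, by rw [dot4_smul, d0, mul_zero], by rw [dot4_smul, d1, mul_zero],
    by rw [dot4_smul, d2, mul_zero], ?_⟩
  rw [dot4_smul_smul, Real.sq_sqrt (by positivity)]
  field_simp

/-- Projection of the velocity `u` onto the plane orthogonal to `x`. -/
def adjustVelocity (x u : V3) : V3 := u - (dot3 x u * (dot3 x x)⁻¹) • x

/-- Correction of the stress `S` that enforces `t u + S x = 0`. -/
def adjustStress (x : V3) (t : ℝ) (u : V3) (S : Mat3) : Mat3 :=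
  S - (dot3 x x)⁻¹ • (outer (t • u + S.mulVec x) x + outer x (t • u + S.mulVec x))
    + (dot3 (t • u + S.mulVec x) x * (dot3 x x)⁻¹ ^ 2) • outer x x

theorem dot3_adjustVelocity {x : V3} (hx : x ≠ 0) (u : V3) : dot3 x (adjustVelocity x u) = 0 := by
  have hr := inv_mul_cancel₀ (dot3_self_pos hx).ne'
  have : dot3 x (adjustVelocity x u) = dot3 x u * (1 - (dot3 x x)⁻¹ * dot3 x x) := by
    simp only [adjustVelocity]
    generalize (dot3 x x)⁻¹ = r
    simp only [dot3_eq, Pi.sub_apply, Pi.smul_apply, smul_eq_mul]; ring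
  rw [this, hr, sub_self, mul_zero]

theorem outer_mulVec (a b c : V3) : (outer a b).mulVec c = dot3 b c • a := by
  ext i
  simp only [outer, Matrix.mulVec, dotProduct, Matrix.of_apply, dot3, Pi.smul_apply, smul_eq_mul,
    Finset.sum_mul]
  exact Finset.sum_congr rfl fun j _ => by ring

theorem adjustStress_mulVec {x : V3} (hx : x ≠ 0) (t : ℝ) (u : V3) (S : Mat3) :
    t • u + (adjustStress x t u S).mulVec x = 0 := by
  have hr := inv_mul_cancel₀ (dot3_self_pos hx).ne'
  rw [adjustStress, Matrix.add_mulVec, Matrix.sub_mulVec, Matrix.smul_mulVec, Matrix.smul_mulVec,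
    Matrix.add_mulVec, outer_mulVec, outer_mulVec, outer_mulVec, smul_add, smul_smul, smul_smul,
    smul_smul, hr, one_smul]
  have : dot3 (t • u + S.mulVec x) x * (dot3 x x)⁻¹ ^ 2 * dot3 x x =
      (dot3 x x)⁻¹ * dot3 (t • u + S.mulVec x) x := by
    rw [pow_two, mul_assoc, mul_assoc, hr]; ring
  rw [this]
  abel

theorem isSymm_adjustStress (x : V3) (t : ℝ) (u : V3) {S : Mat3} (hS : S.IsSymm) :
    (adjustStress x t u S).IsSymm := by
  have h : ∀ a b, (outer a b).transpose = outer b a := fun a b => by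
    ext i j; simp [outer, mul_comm]
  rw [Matrix.IsSymm, adjustStress, Matrix.transpose_add, Matrix.transpose_sub,
    Matrix.transpose_smul, Matrix.transpose_smul, Matrix.transpose_add, h, h, h, hS.eq,
    add_comm (outer x _)]

theorem adjustVelocity_of_dot3_eq_zero {x u : V3} (h : dot3 x u = 0) : adjustVelocity x u = u := by
  simp [adjustVelocity, h]

theorem adjustStress_of_eq_zero {x : V3} {t : ℝ} {u : V3} {S : Mat3}
    (h : t • u + S.mulVec x = 0) : adjustStress x t u S = S := by
  have h₁ : outer 0 x = 0 := by ext; simp [outer]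
  have h₂ : outer x 0 = 0 := by ext; simp [outer]
  have h₃ : dot3 0 x = 0 := by simp [dot3]
  rw [adjustStress, h, h₁, h₂, h₃]
  simp

/-- Contraction of the form dual to `(B, E)` with the vector `(w, s)`. -/
def contract (w : V3) (s : ℝ) (W : MHDState) : V3 × ℝ :=
  (cross3 w W.2.2.1 + s • W.2.2.2, -dot3 w W.2.2.2)

theorem dot3_contract {W : MHDState} (hW : dot3 W.2.2.1 W.2.2.2 = 0) (w : V3) (s : ℝ) :
    dot3 (contract w s W).1 W.2.2.1 = 0 := by
  simp only [contract, dot3_eq, cross3, Pi.add_apply, Pi.smul_apply, smul_eq_mul,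
    Matrix.cons_val] at hW ⊢
  linear_combination s * hW

theorem contract_smul_add_cross3 {W : MHDState} (hW : dot3 W.2.2.1 W.2.2.2 = 0) (w : V3) (s : ℝ) :
    (contract w s W).2 • W.2.2.1 + cross3 (contract w s W).1 W.2.2.2 = 0 := by
  simp only [contract, dot3_eq, cross3, V3.ext_iff', Pi.add_apply, Pi.smul_apply, smul_eq_mul,
    Matrix.cons_val, Pi.zero_apply] at hW ⊢
  refine ⟨?_, ?_, ?_⟩
  · linear_combination -w 0 * hW
  · linear_combination -w 1 * hW
  · linear_combination -w 2 * hW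

/-- Every covector annihilating a nonzero form is a contraction of its dual. -/
theorem exists_contract_eq {W : MHDState} (hW : ¬(W.2.2.1 = 0 ∧ W.2.2.2 = 0)) {x : V3} {t : ℝ}
    (h₁ : dot3 x W.2.2.1 = 0) (h₂ : t • W.2.2.1 + cross3 x W.2.2.2 = 0) :
    ∃ w s, contract w s W = (x, t) := by
  have hN : dot3 W.2.2.1 W.2.2.1 + dot3 W.2.2.2 W.2.2.2 ≠ 0 :=
    (add_dot3_self_pos hW).ne'
  have hr := inv_mul_cancel₀ hN
  generalize (dot3 W.2.2.1 W.2.2.1 + dot3 W.2.2.2 W.2.2.2)⁻¹ = r at hr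
  refine ⟨r • (cross3 W.2.2.1 x - t • W.2.2.2), r * dot3 W.2.2.2 x, ?_⟩
  obtain ⟨u, S, B, E⟩ := W
  simp only [contract, dot3_eq, cross3, V3.ext_iff', Pi.add_apply, Pi.sub_apply, Pi.smul_apply,
    smul_eq_mul, Matrix.cons_val, Pi.zero_apply, Prod.mk.injEq] at h₁ h₂ hr ⊢
  obtain ⟨e0, e1, e2⟩ := h₂
  clear hN hW
  refine ⟨⟨?_, ?_, ?_⟩, ?_⟩ <;> grind

theorem goodSegment_of_annihilates {W V : MHDState} {lam : ℝ} {x : V3} {t : ℝ}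
    (hW : W ∈ MSet) (hS : V.2.1.IsSymm) (hx : x ≠ 0) (hA : Annihilates x t V)
    (h0 : 0 < lam) (h1 : lam < 1) (hp : pair V W = 0)
    (hc : (V.2.2.1 = 0 ∧ V.2.2.2 = 0) ∨
     (dot3 x W.2.2.1 ≠ 0 ∨ t • W.2.2.1 + cross3 x W.2.2.2 ≠ 0) ∨
     (∃ k : ℝ, k ≠ -(1 / lam) ∧ k ≠ 1 / (1 - lam) ∧
       V.2.2.1 = k • W.2.2.1 ∧ V.2.2.2 = k • W.2.2.2 ∧
       ¬(V.2.2.1 = 0 ∧ V.2.2.2 = 0)) ∨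
     (V.1 = 0 ∧ V.2.1 = 0 ∧ W.2.2.1 = 0 ∧ W.2.2.2 = 0)) : GoodSegment W V lam := by
  refine ⟨hW, ⟨hS, x, t, hx, hA⟩, h0, h1, fun s _ _ => ⟨?_, ?_⟩, x, t, hx, hA, hc⟩
  · exact hW.1.add (hS.smul s)
  · have e1 := hW.2
    have e2 := hA.dot3_eq_zero hx
    simp only [pair, dot3_eq, Prod.snd_add, Prod.fst_add, Prod.smul_snd, Prod.smul_fst,
      Pi.add_apply, Pi.smul_apply, smul_eq_mul] at *
    linear_combination e1 + s * hp + s ^ 2 * e2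

theorem GoodSegment.pair_eq_zero {V₀ V : MHDState} {lam : ℝ} (h : GoodSegment V₀ V lam) :
    pair V V₀ = 0 := by
  obtain ⟨hW, -, h0, h1, hs, x, t, hx, hA, -⟩ := h
  have e := (hs lam (by linarith) le_rfl).2
  have e1 := hW.2
  have e2 := hA.dot3_eq_zero hx
  have : lam * pair V V₀ = 0 := by
    simp only [pair, dot3_eq, Prod.snd_add, Prod.fst_add, Prod.smul_snd, Prod.smul_fst,
      Pi.add_apply, Pi.smul_apply, smul_eq_mul] at *
    linear_combination e - e1 - lam ^ 2 * e2
  exact (mul_eq_zero.1 this).resolve_left h0.ne'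

theorem GoodSegment.left_mem {V₀ V : MHDState} {lam : ℝ} (h : GoodSegment V₀ V lam) :
    V₀ + lam • V ∈ MSet :=
  h.2.2.2.2.1 lam (by linarith [h.2.2.2.1]) le_rfl

theorem GoodSegment.right_mem {V₀ V : MHDState} {lam : ℝ} (h : GoodSegment V₀ V lam) :
    V₀ - (1 - lam) • V ∈ MSet := by
  have := h.2.2.2.2.1 (-(1 - lam)) le_rfl (by linarith [h.2.2.1])
  rwa [neg_smul, ← sub_eq_add_neg] at this

end Algebra

section Topology

theorem continuous_stateNorm : Continuous stateNorm := by
  unfold stateNorm; fun_prop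

theorem continuous_dot3 : Continuous fun p : V3 × V3 => dot3 p.1 p.2 := by
  unfold dot3; fun_prop

@[fun_prop]
theorem Continuous.dot3 {X : Type*} [TopologicalSpace X] {f g : X → V3} (hf : Continuous f)
    (hg : Continuous g) : Continuous fun x => dot3 (f x) (g x) :=
  continuous_dot3.comp (hf.prodMk hg)

@[fun_prop]
theorem ContinuousAt.dot3 {X : Type*} [TopologicalSpace X] {f g : X → V3} {x : X}
    (hf : ContinuousAt f x) (hg : ContinuousAt g x) :
    ContinuousAt (fun x => dot3 (f x) (g x)) x :=
  continuous_dot3.continuousAt.comp (hf.prodMk hg)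

@[fun_prop]
theorem Continuous.cross3 {X : Type*} [TopologicalSpace X] {f g : X → V3} (hf : Continuous f)
    (hg : Continuous g) : Continuous fun x => cross3 (f x) (g x) := by
  unfold _root_.cross3
  refine continuous_pi fun i => ?_
  fin_cases i <;> simp <;> fun_prop

theorem continuous_outer : Continuous fun p : V3 × V3 => outer p.1 p.2 := by
  unfold outer
  refine continuous_matrix fun i j => ?_
  simp only [Matrix.of_apply]
  fun_prop

@[fun_prop]
theorem ContinuousAt.outer {X : Type*} [TopologicalSpace X] {f g : X → V3} {x : X}
    (hf : ContinuousAt f x) (hg : ContinuousAt g x) :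
    ContinuousAt (fun x => outer (f x) (g x)) x :=
  continuous_outer.continuousAt.comp (hf.prodMk hg)

@[fun_prop]
theorem ContinuousAt.mulVec3 {X : Type*} [TopologicalSpace X] {f : X → Mat3} {g : X → V3} {x : X}
    (hf : ContinuousAt f x) (hg : ContinuousAt g x) :
    ContinuousAt (fun x => (f x).mulVec (g x)) x := by
  have : Continuous fun p : Mat3 × V3 => p.1.mulVec p.2 :=
    continuous_fst.matrix_mulVec continuous_snd
  exact this.continuousAt.comp (hf.prodMk hg)

@[fun_prop]
theorem Continuous.wedge {X : Type*} [TopologicalSpace X] {f g : X → V3 × ℝ} (hf : Continuous f)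
    (hg : Continuous g) : Continuous fun x => wedge (f x) (g x) := by
  unfold _root_.wedge; fun_prop

@[fun_prop]
theorem Continuous.pair {X : Type*} [TopologicalSpace X] {f g : X → MHDState} (hf : Continuous f)
    (hg : Continuous g) : Continuous fun x => pair (f x) (g x) := by
  unfold _root_.pair; fun_prop

@[fun_prop]
theorem Continuous.cov {X : Type*} [TopologicalSpace X] {f : X → V3 × ℝ} {g : X → MHDState}
    (hf : Continuous f) (hg : Continuous g) : Continuous fun x => cov (f x) (g x) := by
  unfold _root_.cov; fun_prop

@[fun_prop]
theorem Continuous.dot4 {X : Type*} [TopologicalSpace X] {f g : X → V3 × ℝ} (hf : Continuous f)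
    (hg : Continuous g) : Continuous fun x => dot4 (f x) (g x) := by
  unfold _root_.dot4; fun_prop

theorem tendsto_of_stateNorm {V : MHDState} :
    Tendsto id (comap (fun W => stateNorm (W - V)) (𝓝 0)) (𝓝 V) := by
  have key : ∀ f : MHDState → ℝ, (∀ W, |f W - f V| ≤ stateNorm (W - V)) →
      Tendsto f (comap (fun W => stateNorm (W - V)) (𝓝 0)) (𝓝 (f V)) := by
    intro f hf
    rw [tendsto_iff_dist_tendsto_zero]
    exact squeeze_zero (fun _ => dist_nonneg) (fun W => by rw [Real.dist_eq]; exact hf W)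
      tendsto_comap
  have hn : ∀ (g : Fin 3 → ℝ) (i : Fin 3), g i ^ 2 ≤ ∑ i, g i ^ 2 := fun g i =>
    Finset.single_le_sum (f := fun i => g i ^ 2) (fun i _ => sq_nonneg _) (Finset.mem_univ i)
  have hs : ∀ g : Fin 3 → ℝ, 0 ≤ ∑ i, g i ^ 2 := fun g => Finset.sum_nonneg fun i _ => sq_nonneg _
  have hm : ∀ g : Mat3, 0 ≤ ∑ i, ∑ j, g i j ^ 2 := fun g => Finset.sum_nonneg fun i _ => hs _
  rw [nhds_prod_eq, nhds_prod_eq, nhds_prod_eq]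
  refine .prodMk ?_ (.prodMk ?_ (.prodMk ?_ ?_))
  · refine tendsto_pi_nhds.2 fun i => key (fun W => W.1 i) fun W => Real.abs_le_sqrt ?_
    have := hn (W - V).1 i
    have h1 := hm (W - V).2.1
    have h2 := hs (W - V).2.2.1
    have h3 := hs (W - V).2.2.2
    simp only [Prod.fst_sub, Pi.sub_apply] at this h1 h2 h3 ⊢
    linarith
  · refine tendsto_pi_nhds.2 fun i => tendsto_pi_nhds.2 fun j =>
      key (fun W => W.2.1 i j) fun W => Real.abs_le_sqrt ?_
    have := hn ((W - V).2.1 i) j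
    have h0 := Finset.single_le_sum (f := fun i => ∑ j, (W - V).2.1 i j ^ 2)
      (fun i _ => hs _) (Finset.mem_univ i)
    have h1 := hs (W - V).1
    have h2 := hs (W - V).2.2.1
    have h3 := hs (W - V).2.2.2
    have h4 : (W - V).2.1 i j = W.2.1 i j - V.2.1 i j := rfl
    rw [h4] at this
    linarith
  · refine tendsto_pi_nhds.2 fun i => key (fun W => W.2.2.1 i) fun W => Real.abs_le_sqrt ?_
    have := hn (W - V).2.2.1 i
    have h1 := hm (W - V).2.1
    have h2 := hs (W - V).1
    have h3 := hs (W - V).2.2.2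
    have h4 : (W - V).2.2.1 i = W.2.2.1 i - V.2.2.1 i := rfl
    rw [h4] at this
    linarith
  · refine tendsto_pi_nhds.2 fun i => key (fun W => W.2.2.2 i) fun W => Real.abs_le_sqrt ?_
    have := hn (W - V).2.2.2 i
    have h1 := hm (W - V).2.1
    have h2 := hs (W - V).1
    have h3 := hs (W - V).2.2.1
    have h4 : (W - V).2.2.2 i = W.2.2.2 i - V.2.2.2 i := rfl
    rw [h4] at this
    linarith

theorem relOpen_iff {U : Set MHDState} :
    RelOpen U ↔ ∀ V ∈ U, ∀ᶠ W in 𝓝 V, W ∈ MSet → W ∈ U := by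
  refine forall₂_congr fun V _ => ⟨?_, fun h => ?_⟩
  · rintro ⟨δ, hδ, h⟩
    have hc : Continuous fun W => stateNorm (W - V) :=
      continuous_stateNorm.comp (continuous_id.sub continuous_const)
    have h0 : stateNorm (V - V) < δ := by simpa [stateNorm] using hδ
    filter_upwards [hc.continuousAt.eventually_lt continuousAt_const h0] with W hW hM
    exact h W hM hW
  · obtain ⟨s, hs, hsub⟩ := mem_comap.1 (tendsto_of_stateNorm.eventually h)
    obtain ⟨δ, hδ, hb⟩ := Metric.mem_nhds_iff.1 hs
    refine ⟨δ, hδ, fun W hM hW => hsub (hb ?_) hM⟩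
    rw [Metric.mem_ball, dist_zero_right, Real.norm_eq_abs,
      abs_of_nonneg (show 0 ≤ stateNorm (W - V) from Real.sqrt_nonneg _)]
    exact hW

theorem exists_dot4_lt_of_eventually {p : V3 × ℝ → Prop} (h : ∀ᶠ g in 𝓝 (0 : V3 × ℝ), p g) :
    ∃ ε > 0, ∀ g, dot4 g g < ε → p g := by
  obtain ⟨r, hr, hb⟩ := Metric.eventually_nhds_iff.1 h
  refine ⟨r ^ 2, by positivity, fun g hg => hb ?_⟩
  simp only [dot4, dot3_eq] at hg
  rw [dist_zero_right, Prod.norm_def, max_lt_iff, pi_norm_lt_iff hr]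
  have hm := fun x : ℝ => mul_self_nonneg x
  refine ⟨fun i => abs_lt_of_sq_lt_sq ?_ hr.le, abs_lt_of_sq_lt_sq ?_ hr.le⟩
  · fin_cases i <;> simp only [Fin.mk_zero, Fin.mk_one, Fin.reduceFinMk] <;>
      nlinarith [hm (g.1 0), hm (g.1 1), hm (g.1 2), hm g.2]
  · nlinarith [hm (g.1 0), hm (g.1 1), hm (g.1 2), hm g.2]

end Topology

section Hull

/-- Stability of a set under good segments. -/
def GoodClosed (H : Set MHDState) : Prop :=
  ∀ ⦃V₀ V : MHDState⦄ ⦃lam : ℝ⦄, GoodSegment V₀ V lam → V₀ + lam • V ∈ H →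
    V₀ - (1 - lam) • V ∈ H → V₀ ∈ H

/-- `H` contains every state of `ℳ` that is close enough to `V₀`. -/
def NearMem (H : Set MHDState) (V₀ : MHDState) : Prop :=
  ∀ᶠ W in 𝓝 V₀, W ∈ MSet → W ∈ H

variable {H : Set MHDState} {V₀ V : MHDState} {lam : ℝ}

theorem nearMem_of_continuousAt (hH : GoodClosed H) (h₁ : NearMem H (V₀ + lam • V))
    (h₂ : NearMem H (V₀ - (1 - lam) • V)) {F : MHDState → MHDState} (hF : ContinuousAt F V₀)
    (hFV : F V₀ = V) (hgood : ∀ᶠ W in 𝓝 V₀, W ∈ MSet → GoodSegment W (F W) lam) :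
    NearMem H V₀ := by
  subst hFV
  have c₁ : ContinuousAt (fun W => W + lam • F W) V₀ := continuousAt_id.add (hF.const_smul lam)
  have c₂ : ContinuousAt (fun W => W - (1 - lam) • F W) V₀ :=
    continuousAt_id.sub (hF.const_smul (1 - lam))
  filter_upwards [hgood, c₁.eventually h₁, c₂.eventually h₂] with W hW k₁ k₂ hM
  exact hH (hW hM) (k₁ (hW hM).left_mem) (k₂ (hW hM).right_mem)

/-- Near a state whose direction `V` is annihilated by `x`, states `W` that are almost
orthogonal to `V` relative to `x ∧ (B, E)` admit a good segment close to the original one. -/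
theorem exists_eventually_mem_of_annihilates (hH : GoodClosed H)
    (h₁ : NearMem H (V₀ + lam • V)) (h₂ : NearMem H (V₀ - (1 - lam) • V))
    (h0 : 0 < lam) (h1 : lam < 1) (hS : V.2.1.IsSymm) {x : V3 × ℝ} (hx : x.1 ≠ 0)
    (hA : Annihilates x.1 x.2 V) :
    ∃ ε > 0, ∀ᶠ W in 𝓝 V₀, W ∈ MSet →
      pair V W ^ 2 < ε * dot4 (cov x W) (cov x W) → W ∈ H := by
  have c₁ : Continuous fun p : MHDState × (V3 × ℝ) => p.1 + lam • (V + wedge x p.2) := by fun_prop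
  have c₂ : Continuous fun p : MHDState × (V3 × ℝ) => p.1 - (1 - lam) • (V + wedge x p.2) := by
    fun_prop
  have w0 : wedge x 0 = 0 := by simpa using wedge_smul x 0 0
  have k₁ := (c₁.tendsto' (V₀, 0) _ (by simp [w0])).eventually h₁
  have k₂ := (c₂.tendsto' (V₀, 0) _ (by simp [w0])).eventually h₂
  rw [nhds_prod_eq] at k₁ k₂
  obtain ⟨p, hp, q, hq, hpq⟩ := eventually_prod_iff.1 (k₁.and k₂)
  obtain ⟨ε, hε, hεq⟩ := exists_dot4_lt_of_eventually hq
  refine ⟨ε, hε, hp.mono fun W hW hM hlt => ?_⟩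
  set c := cov x W with hc
  have hcpos : 0 < dot4 c c := by nlinarith [sq_nonneg (pair V W)]
  have hg : dot4 ((-(pair V W / dot4 c c)) • c) ((-(pair V W / dot4 c c)) • c) < ε := by
    have : dot4 ((-(pair V W / dot4 c c)) • c) ((-(pair V W / dot4 c c)) • c) =
        pair V W ^ 2 / dot4 c c := by
      rw [dot4_smul_smul]
      field_simp
    rw [this, div_lt_iff₀ hcpos]
    exact hlt
  set g := (-(pair V W / dot4 c c)) • c with hgdef
  have hgood : GoodSegment W (V + wedge x g) lam := by
    refine goodSegment_of_annihilates hM ?_ hx (annihilates_add hA (annihilates_wedge x g)) h0 h1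
      ?_ (.inr (.inl ?_))
    · simpa [wedge] using hS
    · rw [pair_add, pair_wedge, hgdef, dot4_smul, ← hc]
      field_simp
      ring
    · by_contra! hcon
      have : c = 0 := by rw [hc, cov, hcon.1, hcon.2, neg_zero]; rfl
      simp [this, dot4, dot3_eq] at hcpos
  obtain ⟨m₁, m₂⟩ := hpq hW (hεq g hg)
  exact hH hgood (m₁ hgood.left_mem) (m₂ hgood.right_mem)

theorem nearMem_of_cov_ne_zero (hH : GoodClosed H) (h₁ : NearMem H (V₀ + lam • V))
    (h₂ : NearMem H (V₀ - (1 - lam) • V)) (hG : GoodSegment V₀ V lam) {x : V3 × ℝ}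
    (hx : x.1 ≠ 0) (hA : Annihilates x.1 x.2 V) (hc : cov x V₀ ≠ 0) : NearMem H V₀ := by
  obtain ⟨ε, hε, h⟩ := exists_eventually_mem_of_annihilates hH h₁ h₂ hG.2.2.1 hG.2.2.2.1
    hG.2.1.1 hx hA
  have hpos := dot4_self_pos hc
  have hlt : ∀ᶠ W in 𝓝 V₀, pair V W ^ 2 < ε * dot4 (cov x W) (cov x W) := by
    refine ContinuousAt.eventually_lt (by fun_prop) (by fun_prop) ?_
    rw [hG.pair_eq_zero, zero_pow two_ne_zero]
    positivity
  filter_upwards [h, hlt] with W hW k hM using hW hM k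

theorem eventually_mem_of_wedge (hH : GoodClosed H) {a b : V3 × ℝ}
    (h₁ : NearMem H (V₀ + lam • wedge a b)) (h₂ : NearMem H (V₀ - (1 - lam) • wedge a b))
    (h0 : 0 < lam) (h1 : lam < 1) (ha : a.1 ≠ 0) (hb : b.1 ≠ 0)
    (hN : 0 < dot4 a a * dot4 b b - dot4 a b ^ 2) (hB : V₀.2.2.1 = 0) (hE : V₀.2.2.2 = 0) :
    ∀ᶠ W in 𝓝 V₀, W ∈ MSet → cov a W ≠ 0 → W ∈ H := by
  obtain ⟨ε, hε, h⟩ := exists_eventually_mem_of_annihilates hH h₁ h₂ h0 h1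
    Matrix.isSymm_zero hb (wedge_swap a b ▸ annihilates_wedge b (-a))
  have c₁ : Continuous fun p : MHDState × (V3 × ℝ) => p.1 + wedge a p.2 := by fun_prop
  have w0 : wedge a 0 = 0 := by simpa using wedge_smul a 0 0
  have k := (c₁.tendsto' (V₀, 0) _ (by simp [w0])).eventually h
  rw [nhds_prod_eq] at k
  obtain ⟨p, hp, q, hq, hpq⟩ := eventually_prod_iff.1 k
  obtain ⟨δ, hδ, hδq⟩ := exists_dot4_lt_of_eventually hq
  set N := dot4 a a * dot4 b b - dot4 a b ^ 2 with hNdef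
  have hlt : ∀ᶠ W in 𝓝 V₀, pair (wedge a b) W ^ 2 <
      ε * (δ / 2 * N / 2 - dot4 (cov b W) (cov b W)) := by
    refine ContinuousAt.eventually_lt (by fun_prop) (by fun_prop) ?_
    have e1 : pair (wedge a b) V₀ = 0 := by simp [pair, dot3_eq, hB, hE]
    have e2 : dot4 (cov b V₀) (cov b V₀) = 0 := by simp [dot4, cov, cross3, dot3_eq, hB, hE]
    rw [e1, e2, sub_zero, zero_pow two_ne_zero]
    positivity
  filter_upwards [hp, hlt] with W hW hltW hM hcW
  obtain ⟨g, ga, gb, gc, gg⟩ := exists_dot4_orthogonal a b (cov a W) (half_pos hδ)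
  have hmem : ∀ g : V3 × ℝ, dot4 a g = 0 → dot4 b g = 0 → dot4 g g = δ / 2 →
      W + wedge a g ∈ MSet → W + wedge a g ∈ H := by
    intro g ga gb gg hgM
    refine hpq hW (hδq g (by linarith)) hgM ?_
    rw [pair_comm, pair_add, pair_comm (wedge a g), pair_wedge_wedge, add_zero, pair_comm]
    refine hltW.trans_le (mul_le_mul_of_nonneg_left ?_ hε.le)
    have := half_sub_le_dot4_cov b (wedge a g) W
    rwa [dot4_cov_wedge ga gb, gg] at this
  have hgood : GoodSegment W (wedge a ((2 : ℝ) • g)) (1 / 2) := by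
    refine goodSegment_of_annihilates hM Matrix.isSymm_zero ha (annihilates_wedge _ _)
      (by norm_num) (by norm_num) ?_ (.inr (.inl ?_))
    · rw [wedge_smul, two_smul, pair_add, pair_wedge, gc, add_zero]
    · by_contra! hcon
      exact hcW (by rw [cov, hcon.1, hcon.2, neg_zero]; rfl)
  have e1 : W + (1 / 2 : ℝ) • wedge a ((2 : ℝ) • g) = W + wedge a g := by
    rw [wedge_smul, smul_smul]; norm_num
  have e2 : W - (1 - 1 / 2 : ℝ) • wedge a ((2 : ℝ) • g) = W + wedge a (-g) := by
    rw [wedge_smul, smul_smul, wedge_neg]; norm_num; abel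
  have m₁ := hgood.left_mem
  have m₂ := hgood.right_mem
  refine hH hgood ?_ ?_
  · rw [e1] at m₁ ⊢
    exact hmem g ga gb gg m₁
  · rw [e2] at m₂ ⊢
    refine hmem (-g) (by rw [dot4_neg, ga, neg_zero]) (by rw [dot4_neg, gb, neg_zero]) ?_ m₂
    rw [dot4_neg, dot4_comm, dot4_neg, neg_neg, gg]

/-- Base point without electromagnetic part, purely electromagnetic direction. -/
theorem nearMem_of_electromagnetic (hH : GoodClosed H) (h₁ : NearMem H (V₀ + lam • V))
    (h₂ : NearMem H (V₀ - (1 - lam) • V)) (h0 : 0 < lam) (h1 : lam < 1) {a : V3 × ℝ}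
    (ha : a.1 ≠ 0) (hA : Annihilates a.1 a.2 V) (hu : V.1 = 0) (hS : V.2.1 = 0)
    (hV : ¬(V.2.2.1 = 0 ∧ V.2.2.2 = 0)) (hB : V₀.2.2.1 = 0) (hE : V₀.2.2.2 = 0) :
    NearMem H V₀ := by
  obtain ⟨b, hb, rfl⟩ := hA.exists_wedge ha hu hS
  have hN : 0 < dot4 a a * dot4 b b - dot4 a b ^ 2 := by
    rw [dot4_gram]
    exact add_dot3_self_pos hV
  have hca := eventually_mem_of_wedge hH h₁ h₂ h0 h1 ha hb hN hB hE
  have hcb : ∀ᶠ W in 𝓝 V₀, W ∈ MSet → cov b W ≠ 0 → W ∈ H := by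
    rw [wedge_swap] at h₁ h₂
    refine eventually_mem_of_wedge hH h₁ h₂ h0 h1 hb (by simpa using ha) ?_ hB hE
    rw [dot4_neg, dot4_neg, dot4_comm (-a), dot4_neg, dot4_comm b a]
    linarith
  set m : MHDState → ℝ := fun W =>
    (dot3 (wedge a b).2.2.1 W.2.2.1 + dot3 (wedge a b).2.2.2 W.2.2.2) /
      (dot4 a a * dot4 b b - dot4 a b ^ 2) with hm
  have hmc : Continuous m := by simp only [hm]; fun_prop
  have hm0 : m V₀ = 0 := by simp [hm, hB, hE, dot3_eq]
  have l₁ : ∀ᶠ W in 𝓝 V₀, -lam < m W :=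
    continuousAt_const.eventually_lt hmc.continuousAt (by rw [hm0]; linarith)
  have l₂ : ∀ᶠ W in 𝓝 V₀, m W < 1 - lam :=
    hmc.continuousAt.eventually_lt continuousAt_const (by rw [hm0]; linarith)
  have c₁ : ContinuousAt (fun W => W + lam • wedge a b) V₀ := by fun_prop
  have c₂ : ContinuousAt (fun W => W - (1 - lam) • wedge a b) V₀ := by fun_prop
  filter_upwards [hca, hcb, l₁, l₂, c₁.eventually h₁, c₂.eventually h₂]
    with W ka kb m₁ m₂ k₁ k₂ hM
  by_cases za : cov a W = 0
  swap
  · exact ka hM za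
  by_cases zb : cov b W = 0
  swap
  · exact kb hM zb
  obtain ⟨eB, eE⟩ := eq_smul_wedge za zb hN
  change W.2.2.1 = m W • _ at eB
  change W.2.2.2 = m W • _ at eE
  have hgood : GoodSegment W (wedge a b) lam := by
    refine goodSegment_of_annihilates hM Matrix.isSymm_zero ha (annihilates_wedge a b) h0 h1
      (by rw [pair_wedge, za]; simp [dot4, dot3_eq]) (.inr (.inr ?_))
    by_cases hmW : m W = 0
    · exact .inr ⟨rfl, rfl, by rw [eB, hmW, zero_smul], by rw [eE, hmW, zero_smul]⟩
    · refine .inl ⟨(m W)⁻¹, ?_, ?_, ?_, ?_, hV⟩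
      · rw [one_div, ← inv_neg]
        exact fun h => m₁.ne' (inv_injective h)
      · rw [one_div]
        exact fun h => m₂.ne (inv_injective h)
      · rw [eB, inv_smul_smul₀ hmW]
      · rw [eE, inv_smul_smul₀ hmW]
  exact hH hgood (k₁ hgood.left_mem) (k₂ hgood.right_mem)

/-- Direction whose electromagnetic part is proportional to that of the base point. -/
theorem nearMem_of_parallel (hH : GoodClosed H) (h₁ : NearMem H (V₀ + lam • V))
    (h₂ : NearMem H (V₀ - (1 - lam) • V)) (h0 : 0 < lam) (h1 : lam < 1) {x : V3} {t : ℝ}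
    (hx : x ≠ 0) (hS : V.2.1.IsSymm) (hA : Annihilates x t V) {k : ℝ} (hk₁ : k ≠ -(1 / lam))
    (hk₂ : k ≠ 1 / (1 - lam)) (hB : V.2.2.1 = k • V₀.2.2.1) (hE : V.2.2.2 = k • V₀.2.2.2)
    (hV : ¬(V.2.2.1 = 0 ∧ V.2.2.2 = 0)) : NearMem H V₀ := by
  have hk : k ≠ 0 := by rintro rfl; simp [hB, hE] at hV
  have hV₀ : ¬(V₀.2.2.1 = 0 ∧ V₀.2.2.2 = 0) := fun h => hV (by simp [hB, hE, h.1, h.2])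
  obtain ⟨w, s, hws⟩ : ∃ w s, contract w s V₀ = (x, t) := by
    obtain ⟨-, a₂, -, a₄⟩ := hA
    refine exists_contract_eq hV₀ ?_ ?_
    · rw [hB] at a₂
      refine (mul_eq_zero.1 (?_ : k * _ = 0)).resolve_left hk
      rw [← a₂]
      simp only [dot3_eq, Pi.smul_apply, smul_eq_mul]; ring
    · rw [hB, hE] at a₄
      refine (smul_eq_zero.1 (?_ : k • (_ : V3) = 0)).resolve_left hk
      rw [← a₄, V3.ext_iff']
      simp only [cross3, Pi.add_apply, Pi.smul_apply, smul_eq_mul, Matrix.cons_val]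
      refine ⟨?_, ?_, ?_⟩ <;> ring
  have hcont : Continuous (contract w s) := by unfold contract; fun_prop
  set y : MHDState → V3 := fun W => (contract w s W).1 with hy
  set τ : MHDState → ℝ := fun W => (contract w s W).2 with hτ
  have hy0 : y V₀ = x := by simp [hy, hws]
  have hτ0 : τ V₀ = t := by simp [hτ, hws]
  have hyc : Continuous y := continuous_fst.comp hcont
  have hτc : Continuous τ := continuous_snd.comp hcont
  have hinv : ContinuousAt (fun W => (dot3 (y W) (y W))⁻¹) V₀ :=
    ContinuousAt.inv₀ (by fun_prop) (by rw [hy0]; exact (dot3_self_pos hx).ne')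
  have hvel : ContinuousAt (fun W => adjustVelocity (y W) V.1) V₀ := by
    unfold adjustVelocity; fun_prop
  have hstr : ContinuousAt (fun W =>
      adjustStress (y W) (τ W) (adjustVelocity (y W) V.1) V.2.1) V₀ := by
    unfold adjustStress; fun_prop
  refine nearMem_of_continuousAt hH h₁ h₂
    (F := fun W => (adjustVelocity (y W) V.1,
      adjustStress (y W) (τ W) (adjustVelocity (y W) V.1) V.2.1, k • W.2.2.1, k • W.2.2.2))
    (by fun_prop) ?_ ?_
  · simp only [hy0, hτ0, adjustVelocity_of_dot3_eq_zero hA.1, adjustStress_of_eq_zero hA.2.2.1,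
      ← hB, ← hE]
  · have e₁ : ∀ᶠ W in 𝓝 V₀, y W ≠ 0 := hyc.continuousAt.eventually_ne (by rwa [hy0])
    have e₂ : ∀ᶠ W : MHDState in 𝓝 V₀, dot3 W.2.2.1 W.2.2.1 + dot3 W.2.2.2 W.2.2.2 ≠ 0 :=
      ContinuousAt.eventually_ne (by fun_prop) (add_dot3_self_pos hV₀).ne'
    filter_upwards [e₁, e₂] with W hyW hW hM
    refine goodSegment_of_annihilates (x := y W) (t := τ W) hM (isSymm_adjustStress _ _ _ hS) hyW
      ⟨dot3_adjustVelocity hyW _, ?_, adjustStress_mulVec hyW _ _ _, ?_⟩ h0 h1 ?_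
      (.inr (.inr (.inl ⟨k, hk₁, hk₂, rfl, rfl, ?_⟩)))
    · have := dot3_contract hM.2 w s
      simp only [hy, dot3_eq, Pi.smul_apply, smul_eq_mul] at this ⊢
      linear_combination k * this
    · have := contract_smul_add_cross3 hM.2 w s
      simp only [hy, hτ, V3.ext_iff', cross3, Pi.add_apply, Pi.smul_apply, smul_eq_mul,
        Matrix.cons_val, Pi.zero_apply] at this ⊢
      obtain ⟨q0, q1, q2⟩ := this
      exact ⟨by linear_combination k * q0, by linear_combination k * q1,
        by linear_combination k * q2⟩
    · have := hM.2
      simp only [pair, dot3_eq, Pi.smul_apply, smul_eq_mul] at this ⊢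
      linear_combination 2 * k * this
    · rintro ⟨z₁, z₂⟩
      have z₁' := (smul_eq_zero.1 z₁).resolve_left hk
      have z₂' := (smul_eq_zero.1 z₂).resolve_left hk
      exact hW (by simp [z₁', z₂', dot3_eq])

theorem GoodSegment.nearMem (hG : GoodSegment V₀ V lam) (hH : GoodClosed H)
    (h₁ : NearMem H (V₀ + lam • V)) (h₂ : NearMem H (V₀ - (1 - lam) • V)) : NearMem H V₀ := by
  obtain ⟨-, hΛ, h0, h1, -, x, t, hx, hA, hc⟩ := id hG
  by_cases hV : V.2.2.1 = 0 ∧ V.2.2.2 = 0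
  · refine nearMem_of_continuousAt hH h₁ h₂ (F := fun _ => V) continuousAt_const rfl
      (.of_forall fun W hM => ?_)
    exact goodSegment_of_annihilates hM hΛ.1 hx hA h0 h1 (by simp [pair, hV.1, hV.2, dot3_eq])
      (.inl hV)
  · rcases hc with hc | hc | ⟨k, hk₁, hk₂, hB, hE, -⟩ | ⟨hu, hS, hB, hE⟩
    · exact absurd hc hV
    · refine nearMem_of_cov_ne_zero hH h₁ h₂ hG (x := (x, t)) hx hA fun h => ?_
      simp only [cov, Prod.mk_eq_zero, neg_eq_zero] at h
      exact hc.elim (absurd h.2) (absurd h.1)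
    · exact nearMem_of_parallel hH h₁ h₂ h0 h1 hx hΛ.1 hA hk₁ hk₂ hB hE hV
    · exact nearMem_of_electromagnetic hH h₁ h₂ h0 h1 (a := (x, t)) hx hA hu hS hV hB hE

theorem monotone_lamHullG (Y : Set MHDState) : Monotone (lamHullG Y) :=
  monotone_nat_of_le_succ fun _ => Set.subset_union_left

theorem goodClosed_lcHullG (Y : Set MHDState) : GoodClosed (lcHullG Y) := by
  intro V₀ V lam hG h₁ h₂
  obtain ⟨i, hi⟩ := Set.mem_iUnion.1 h₁
  obtain ⟨j, hj⟩ := Set.mem_iUnion.1 h₂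
  exact Set.mem_iUnion.2 ⟨max i j + 1, .inr ⟨lam, V, hG,
    monotone_lamHullG Y (le_max_left i j) hi, monotone_lamHullG Y (le_max_right i j) hj⟩⟩

end Hull

/-- If 𝒰 ⊆ ℳ is relatively open in ℳ, then 𝒰^{lc,Λ_g} is relatively open in ℳ. -/
theorem stmt10 (U : Set MHDState) (hU : U ⊆ MSet) (hopen : RelOpen U) :
    RelOpen (lcHullG U) := by
  rw [relOpen_iff] at hopen ⊢
  have key : ∀ k, ∀ V ∈ lamHullG U k, NearMem (lcHullG U) V := by
    intro k
    induction k with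
    | zero => exact fun V hV => (hopen V hV).mono fun W hW hM => Set.mem_iUnion.2 ⟨0, hW hM⟩
    | succ k ih =>
      rintro V₀ (hV | ⟨lam, V, hG, h₁, h₂⟩)
      · exact ih V₀ hV
      · exact hG.nearMem (goodClosed_lcHullG U) (ih _ h₁) (ih _ h₂)
  intro V hV
  obtain ⟨k, hk⟩ := Set.mem_iUnion.1 hV
  exact key k V hk
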